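/- Let G be the dihedral group of order 8, W the 7-dimensional sum-zero subrepresentation of its complex left regular representation, Sym²W its symmetric square, and χ₁ : G → ℂ the character with χ₁(r^i) = 1 on rotations and χ₁(s r^i) = −1 on reflections. Then the complex vector space of linear maps f : Sym²W → ℂ satisfying f(g • x) = χ₁(g) · f(x) for all g ∈ G and x ∈ Sym²W has dimension 2. -/

import Mathlib

open scoped TensorProduct

set_option synthInstance.maxHeartbeats 1000000
set_option maxHeartbeats 1000000

/-- The left regular action of `g` on functions `DihedralGroup 4 → ℂ`:
`(reg g f) x = f (g⁻¹ * x)`. -/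
noncomputable def reg (g : DihedralGroup 4) :
    (DihedralGroup 4 → ℂ) →ₗ[ℂ] (DihedralGroup 4 → ℂ) :=
  LinearMap.funLeft ℂ ℂ (fun x => g⁻¹ * x)

/-- The subspace of sum-zero functions: the regular representation minus the
trivial representation; it is 7-dimensional. -/
noncomputable def W : Submodule ℂ (DihedralGroup 4 → ℂ) :=
  LinearMap.ker (∑ x : DihedralGroup 4, LinearMap.proj x :
    (DihedralGroup 4 → ℂ) →ₗ[ℂ] ℂ)

lemma reg_mem_W (g : DihedralGroup 4) {f : DihedralGroup 4 → ℂ} (hf : f ∈ W) :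
    reg g f ∈ W := by
  simp only [W, LinearMap.mem_ker, LinearMap.sum_apply, LinearMap.proj_apply] at hf ⊢
  calc ∑ x : DihedralGroup 4, reg g f x
      = ∑ x : DihedralGroup 4, f x :=
        Fintype.sum_equiv (Equiv.mulLeft g⁻¹) _ _ (fun x => rfl)
    _ = 0 := hf

/-- The action of `g` on `W`. -/
noncomputable def regW (g : DihedralGroup 4) : W →ₗ[ℂ] W :=
  (reg g).restrict (fun _ hf => reg_mem_W g hf)

noncomputable instance : AddCommGroup (↥W ⊗[ℂ] ↥W) := TensorProduct.addCommGroup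

/-- The diagonal action of `g` on `W ⊗ W`. -/
noncomputable def tenAct (g : DihedralGroup 4) : (↥W ⊗[ℂ] ↥W) →ₗ[ℂ] (↥W ⊗[ℂ] ↥W) :=
  TensorProduct.map (regW g) (regW g)

/-- The subspace of `W ⊗ W` spanned by the elements `x ⊗ y - y ⊗ x`. -/
noncomputable def symRel : Submodule ℂ (↥W ⊗[ℂ] ↥W) :=
  Submodule.span ℂ {z | ∃ x y : W, z = x ⊗ₜ[ℂ] y - y ⊗ₜ[ℂ] x}

/-- The symmetric square `Sym² W`: the quotient of `W ⊗ W` by the span of the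
elements `x ⊗ y - y ⊗ x`. -/
noncomputable abbrev Sym2W : Type := (↥W ⊗[ℂ] ↥W) ⧸ symRel

lemma symRel_le (g : DihedralGroup 4) : symRel ≤ symRel.comap (tenAct g) := by
  rw [symRel, Submodule.span_le]
  rintro z ⟨x, y, rfl⟩
  simp only [Submodule.mem_comap, map_sub, tenAct, TensorProduct.map_tmul]
  exact Submodule.subset_span ⟨regW g x, regW g y, rfl⟩

/-- The induced action of `g` on `Sym² W`. -/
noncomputable def symAct (g : DihedralGroup 4) : Sym2W →ₗ[ℂ] Sym2W :=
  Submodule.mapQ symRel symRel (tenAct g) (symRel_le g)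

/-- The space of `χ`-equivariant linear functionals on `Sym² W`. -/
noncomputable def eqMaps (χ : DihedralGroup 4 → ℂ) : Submodule ℂ (Sym2W →ₗ[ℂ] ℂ) where
  carrier := {f | ∀ (g : DihedralGroup 4) (x : Sym2W), f (symAct g x) = χ g * f x}
  add_mem' := by
    intro a b ha hb g x
    simp only [LinearMap.add_apply, ha g x, hb g x]
    ring
  zero_mem' := by
    intro g x
    simp
  smul_mem' := by
    intro c f hf g x
    simp only [LinearMap.smul_apply, hf g x, smul_eq_mul]
    ring

/-- The character of `DihedralGroup 4` that is `1` on rotations and `-1` on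
reflections (the determinant of the 2-dimensional irreducible representation). -/
noncomputable def chi1 : DihedralGroup 4 → ℂ
  | .r _ => 1
  | .sr _ => -1

lemma chi1_mul (g h : DihedralGroup 4) : chi1 (g * h) = chi1 g * chi1 h := by
  rcases g with i | i <;> rcases h with j | j <;>
    simp [chi1, DihedralGroup.r_mul_r, DihedralGroup.r_mul_sr, DihedralGroup.sr_mul_r,
      DihedralGroup.sr_mul_sr]

lemma chi1_mul_self (g : DihedralGroup 4) : chi1 g * chi1 g = 1 := by
  rcases g with i | i <;> simp [chi1]

lemma sum_dihedralGroup_four (f : DihedralGroup 4 → ℂ) :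
    ∑ x, f x = (f (.r 0) + f (.r 1) + f (.r 2) + f (.r 3)) +
      (f (.sr 0) + f (.sr 1) + f (.sr 2) + f (.sr 3)) := by
  let e : ZMod 4 ⊕ ZMod 4 ≃ DihedralGroup 4 :=
    { toFun := Sum.elim .r .sr
      invFun := fun x => match x with
        | .r i => .inl i
        | .sr i => .inr i
      left_inv := by rintro (i | i) <;> rfl
      right_inv := by rintro (i | i) <;> rfl }
  rw [← e.sum_comp f, Fintype.sum_sum_type]
  exact congrArg₂ (· + ·) (Fin.sum_univ_four fun i => f (.r i))
    (Fin.sum_univ_four fun i => f (.sr i))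

lemma mem_W {f : DihedralGroup 4 → ℂ} : f ∈ W ↔ ∑ x, f x = 0 := by
  simp [W, LinearMap.mem_ker, LinearMap.sum_apply]

/-- The projection to `W` of the indicator function of `a`. -/
noncomputable def centeredSingle (a : DihedralGroup 4) : W :=
  ⟨fun x => (if x = a then 1 else 0) - 1 / 8, by
    rw [mem_W, Finset.sum_sub_distrib]
    simp [DihedralGroup.card]⟩

lemma regW_centeredSingle (g a : DihedralGroup 4) :
    regW g (centeredSingle a) = centeredSingle (g * a) := by
  ext x
  simp [regW, reg, centeredSingle, LinearMap.restrict_apply, LinearMap.funLeft_apply,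
    inv_mul_eq_iff_eq_mul]

lemma eq_sum_centeredSingle (w : W) : w = ∑ a, (w : DihedralGroup 4 → ℂ) a • centeredSingle a := by
  have hw := mem_W.1 w.2
  ext x
  simp [centeredSingle, mul_sub, Finset.sum_sub_distrib, ← Finset.sum_mul, hw]

lemma sum_centeredSingle : ∑ a, centeredSingle a = 0 := by
  ext x
  simp [centeredSingle, Finset.sum_sub_distrib, DihedralGroup.card]

/-- The value of a functional on `Sym² W` at the product of two centered indicators. -/
noncomputable def gram (a b : DihedralGroup 4) : (Sym2W →ₗ[ℂ] ℂ) →ₗ[ℂ] ℂ :=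
  LinearMap.applyₗ (symRel.mkQ (centeredSingle a ⊗ₜ[ℂ] centeredSingle b))

lemma gram_apply (a b : DihedralGroup 4) (f : Sym2W →ₗ[ℂ] ℂ) :
    gram a b f = f (symRel.mkQ (centeredSingle a ⊗ₜ[ℂ] centeredSingle b)) := rfl

lemma gram_comm (a b : DihedralGroup 4) (f : Sym2W →ₗ[ℂ] ℂ) : gram a b f = gram b a f := by
  rw [gram_apply, gram_apply]
  congr 1
  exact (Submodule.Quotient.eq symRel).2 (Submodule.subset_span ⟨_, _, rfl⟩)

lemma sum_gram (a : DihedralGroup 4) (f : Sym2W →ₗ[ℂ] ℂ) : ∑ b, gram a b f = 0 := by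
  simp only [gram_apply]
  rw [← map_sum, ← map_sum, ← TensorProduct.tmul_sum, sum_centeredSingle,
    TensorProduct.tmul_zero, map_zero, map_zero]

lemma gram_mul {χ : DihedralGroup 4 → ℂ} {f : Sym2W →ₗ[ℂ] ℂ} (hf : f ∈ eqMaps χ)
    (g a b : DihedralGroup 4) : gram (g * a) (g * b) f = χ g * gram a b f := by
  rw [gram_apply, gram_apply, ← hf g, ← regW_centeredSingle, ← regW_centeredSingle]
  rfl

lemma eq_zero_of_gram_eq_zero {f : Sym2W →ₗ[ℂ] ℂ} (h : ∀ a b, gram a b f = 0) : f = 0 := by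
  apply Submodule.linearMap_qext
  apply TensorProduct.ext'
  intro x y
  rw [eq_sum_centeredSingle x, eq_sum_centeredSingle y, TensorProduct.sum_tmul, map_sum]
  refine Finset.sum_eq_zero fun a _ => ?_
  rw [TensorProduct.tmul_sum, map_sum]
  refine Finset.sum_eq_zero fun b _ => ?_
  rw [TensorProduct.smul_tmul_smul, map_smul]
  exact smul_eq_zero_of_right _ (h a b)

/-- The first row of the Gram matrix of a `χ₁`-equivariant symmetric form on `W`. -/
noncomputable def kernelRow (c : ℂ × ℂ) : DihedralGroup 4 → ℂ
  | .r i => (![c.1, c.2, -c.1 - 2 * c.2, c.2] : Fin 4 → ℂ) i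
  | .sr _ => 0

lemma kernelRow_inv (c : ℂ × ℂ) (g : DihedralGroup 4) :
    kernelRow c g⁻¹ = chi1 g * kernelRow c g := by
  rcases g with i | i
  · change kernelRow c (.r (-i)) = 1 * _
    rw [one_mul]
    fin_cases i <;> rfl
  · change (0 : ℂ) = _ * 0
    simp

lemma sum_kernelRow (c : ℂ × ℂ) : ∑ g, kernelRow c g = 0 := by
  rw [sum_dihedralGroup_four]
  change (c.1 + c.2 + (-c.1 - 2 * c.2) + c.2) + (0 + 0 + 0 + 0) = 0
  ring

/-- The Gram matrix with first row `kernelRow c`. -/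
noncomputable def kernelMatrix (c : ℂ × ℂ) (a b : DihedralGroup 4) : ℂ :=
  chi1 a * kernelRow c (a⁻¹ * b)

lemma kernelMatrix_comm (c : ℂ × ℂ) (a b : DihedralGroup 4) :
    kernelMatrix c a b = kernelMatrix c b a := by
  have h : a⁻¹ * b = (b⁻¹ * a)⁻¹ := by group
  have hab : chi1 a = chi1 b * chi1 (b⁻¹ * a) := by rw [← chi1_mul, mul_inv_cancel_left]
  rw [kernelMatrix, kernelMatrix, h, kernelRow_inv, hab]
  linear_combination (chi1 b * kernelRow c (b⁻¹ * a)) * chi1_mul_self (b⁻¹ * a)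

lemma kernelMatrix_mul (c : ℂ × ℂ) (g a b : DihedralGroup 4) :
    kernelMatrix c (g * a) (g * b) = chi1 g * kernelMatrix c a b := by
  have h : (g * a)⁻¹ * (g * b) = a⁻¹ * b := by group
  rw [kernelMatrix, kernelMatrix, h, chi1_mul, mul_assoc]

lemma sum_kernelMatrix (c : ℂ × ℂ) (a : DihedralGroup 4) : ∑ b, kernelMatrix c a b = 0 := by
  simp only [kernelMatrix, ← Finset.mul_sum]
  have h : ∑ b, kernelRow c (a⁻¹ * b) = ∑ b, kernelRow c b :=
    Equiv.sum_comp (Equiv.mulLeft a⁻¹) (kernelRow c)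
  rw [h, sum_kernelRow, mul_zero]

/-- The bilinear form on functions with matrix `kernelMatrix c`. -/
noncomputable def kernelForm (c : ℂ × ℂ) :
    (DihedralGroup 4 → ℂ) →ₗ[ℂ] (DihedralGroup 4 → ℂ) →ₗ[ℂ] ℂ :=
  Matrix.toLinearMap₂' ℂ (Matrix.of (kernelMatrix c))

lemma kernelForm_apply (c : ℂ × ℂ) (x y : DihedralGroup 4 → ℂ) :
    kernelForm c x y = ∑ a, ∑ b, x a * y b * kernelMatrix c a b := by
  simp [kernelForm, Matrix.toLinearMap₂'_apply, mul_assoc]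

lemma kernelForm_comm (c : ℂ × ℂ) (x y : DihedralGroup 4 → ℂ) :
    kernelForm c x y = kernelForm c y x := by
  rw [kernelForm_apply, kernelForm_apply, Finset.sum_comm]
  refine Finset.sum_congr rfl fun a _ => Finset.sum_congr rfl fun b _ => ?_
  rw [kernelMatrix_comm, mul_comm (x b)]

lemma kernelForm_reg (c : ℂ × ℂ) (g : DihedralGroup 4) (x y : DihedralGroup 4 → ℂ) :
    kernelForm c (reg g x) (reg g y) = chi1 g * kernelForm c x y := by
  rw [kernelForm_apply, kernelForm_apply, ← Equiv.sum_comp (Equiv.mulLeft g), Finset.mul_sum]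
  refine Finset.sum_congr rfl fun a _ => ?_
  rw [← Equiv.sum_comp (Equiv.mulLeft g), Finset.mul_sum]
  refine Finset.sum_congr rfl fun b _ => ?_
  simp only [reg, LinearMap.funLeft_apply, Equiv.coe_mulLeft, inv_mul_cancel_left,
    kernelMatrix_mul]
  ring

lemma kernelForm_centeredSingle (c : ℂ × ℂ) (a b : DihedralGroup 4) :
    kernelForm c (centeredSingle a) (centeredSingle b) = kernelMatrix c a b := by
  have hcol (b : DihedralGroup 4) : ∑ a, kernelMatrix c a b = 0 := by
    simp only [kernelMatrix_comm c _ b, sum_kernelMatrix]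
  have hrow (a' : DihedralGroup 4) :
      ∑ b', (centeredSingle b : DihedralGroup 4 → ℂ) b' * kernelMatrix c a' b' =
        kernelMatrix c a' b := by
    simp [centeredSingle, sub_mul, Finset.sum_sub_distrib, ← Finset.mul_sum, sum_kernelMatrix]
  rw [kernelForm_apply]
  simp only [mul_assoc, ← Finset.mul_sum, hrow]
  simp [centeredSingle, sub_mul, Finset.sum_sub_distrib, ← Finset.mul_sum, hcol]

/-- The functional on `Sym² W` induced by `kernelForm c`. -/
noncomputable def kernelFunctional (c : ℂ × ℂ) : Sym2W →ₗ[ℂ] ℂ :=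
  symRel.liftQ (TensorProduct.lift ((kernelForm c).compl₁₂ W.subtype W.subtype)) <| by
    rw [symRel, Submodule.span_le]
    rintro z ⟨x, y, rfl⟩
    rw [SetLike.mem_coe, LinearMap.mem_ker, map_sub, sub_eq_zero]
    exact kernelForm_comm c x y

lemma kernelFunctional_mem (c : ℂ × ℂ) : kernelFunctional c ∈ eqMaps chi1 := by
  intro g x
  have h : kernelFunctional c ∘ₗ symAct g = chi1 g • kernelFunctional c := by
    apply Submodule.linearMap_qext
    apply TensorProduct.ext'
    intro x y
    exact kernelForm_reg c g x y
  exact LinearMap.congr_fun h x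

lemma gram_kernelFunctional (c : ℂ × ℂ) (a b : DihedralGroup 4) :
    gram a b (kernelFunctional c) = kernelMatrix c a b :=
  kernelForm_centeredSingle c a b

/-- The two Gram entries which determine a `χ₁`-equivariant functional. -/
noncomputable def gramPair : eqMaps chi1 →ₗ[ℂ] ℂ × ℂ :=
  ((gram 1 1).prod (gram 1 (.r 1))) ∘ₗ (eqMaps chi1).subtype

lemma gramPair_injective : Function.Injective gramPair := by
  rw [← LinearMap.ker_eq_bot, LinearMap.ker_eq_bot']
  rintro ⟨f, hf⟩ h
  have h0 : gram 1 (.r 0) f = 0 := congrArg Prod.fst h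
  have h1 : gram 1 (.r 1) f = 0 := congrArg Prod.snd h
  have hinv (g : DihedralGroup 4) : gram 1 g⁻¹ f = chi1 g * gram 1 g f := by
    have := gram_mul hf g 1 g⁻¹
    rw [mul_one, mul_inv_cancel, gram_comm] at this
    linear_combination (-chi1 g) * this - gram 1 g⁻¹ f * chi1_mul_self g
  have hs (i : ZMod 4) : gram 1 (.sr i) f = 0 := by
    have : gram 1 (.sr i) f = -1 * gram 1 (.sr i) f := hinv (.sr i)
    linear_combination this / 2
  have h3 : gram 1 (.r 3) f = 0 := by
    have : gram 1 (.r 3) f = 1 * gram 1 (.r 1) f := hinv (.r 1)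
    rw [this, h1, mul_zero]
  have h2 : gram 1 (.r 2) f = 0 := by
    have := sum_gram 1 f
    rw [sum_dihedralGroup_four (fun b => gram 1 b f)] at this
    simpa only [h0, h1, h3, hs, zero_add, add_zero] using this
  have hall (g : DihedralGroup 4) : gram 1 g f = 0 := by
    rcases g with i | i
    · fin_cases i
      exacts [h0, h1, h2, h3]
    · exact hs i
  refine Subtype.ext (eq_zero_of_gram_eq_zero fun a b => ?_)
  have := gram_mul hf a 1 (a⁻¹ * b)
  rwa [mul_one, mul_inv_cancel_left, hall, mul_zero] at this

lemma gramPair_surjective : Function.Surjective gramPair := by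
  intro c
  refine ⟨⟨kernelFunctional c, kernelFunctional_mem c⟩, Prod.ext ?_ ?_⟩
  · refine (gram_kernelFunctional c 1 1).trans ?_
    rw [kernelMatrix, inv_one, one_mul]
    exact one_mul c.1
  · refine (gram_kernelFunctional c 1 (.r 1)).trans ?_
    rw [kernelMatrix, inv_one, one_mul]
    exact one_mul c.2

/-- The multiplicity of the character `χ₁` in `Sym² W` is 2. -/
theorem finrank_eqMaps_chi1_eq_two : Module.finrank ℂ (eqMaps chi1) = 2 := by
  rw [(LinearEquiv.ofBijective gramPair ⟨gramPair_injective, gramPair_surjective⟩).finrank_eq]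
  simp
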